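/- The map T ↦ T̃ (complement the straightened right column within [n] and stack above the straightened left column) is a bijection between T^{c_n}(a) and the set of Kashiwara-Nakashima columns of type C_n of shape (1^{n−a}), which moreover commutes with all Kashiwara operators ẽ_i, f̃_i for 1 ≤ i ≤ n and preserves weights; hence it is an isomorphism of c_n-crystals T^{c_n}(a) ≅ KN^{c_n}_{(1^{n−a})}. -/

import Mathlib

/-!
Statement 9: the map `T ↦ T̃` is a bijection from `T^{c_n}(a)` onto the set of KN columns
of type `C_n` of shape `(1^{n−a})`, commuting with all Kashiwara operators `ẽ_i`, `f̃_i`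
(`1 ≤ i ≤ n`) and preserving weights; hence it is an isomorphism of `c_n`-crystals
`T^{c_n}(a) ≅ KN^{c_n}_{(1^{n−a})}`.

Encodings: `𝕁_n^× = {1<⋯<n<n̄<⋯<1̄}` is `{0,…,2n−1}` (letter `k` is `k−1`, `k̄` is `2n−k`),
`[n̄]` is `{n,…,2n−1}`.  The crystal structure of `T^{c_n}(a)` is given by the pre-crystal
`pairPC`: for `i < n` via the reading word (gl_n-structure from the dual natural
representation), and `ẽ_n` removes a domino of two `n̄`'s from the top; the crystal
structure on KN columns is induced from the one-box type `C_n` crystal via the column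
word.  Weights: the spinor-model weight is `ω_n + wt_𝔩`.
-/

namespace KN

/-- The `i`-th entry from the bottom (1-indexed) of a column written top-to-bottom. -/
def getB (l : List ℕ) (i : ℕ) : Option ℕ :=
  if 1 ≤ i ∧ i ≤ l.length then l[l.length - i]? else none

/-- Semistandardness of a two-column skew tableau of shape `λ(a,b,c)` with left column `L`
(of length `c+a`), right column `R` (of length `b+c`), both written top-to-bottom:
columns strictly increase and, in each of the `c` overlapping rows, the left entry is
no greater than the right entry. -/
def PairSSD (b : ℕ) (L R : List ℕ) : Prop :=
  L.Chain' (· < ·) ∧ R.Chain' (· < ·) ∧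
    ∀ i x y, L[i]? = some x → R[b + i]? = some y → x ≤ y

/-- `r_T = 0`: the right column of `T` cannot be slid down one position while keeping
semistandardness (automatic when `a = 0` or `b = 0`). -/
def SlideZero (a b : ℕ) (L R : List ℕ) : Prop :=
  a = 0 ∨ b = 0 ∨ ∃ i x y, L[i]? = some x ∧ R[b + i - 1]? = some y ∧ y < x

/-- State of a two-column skew tableau: `(b, L, R)` where `b` is the shape parameter
(length of the empty upper part of the left column). -/
abbrev TC := ℕ × List ℕ × List ℕ

def FCond (b : ℕ) (L R : List ℕ) (i : ℕ) : Bool :=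
  match L[i]?, R[b - 1 + i]? with
  | _, none => false
  | none, some _ => true
  | some x, some y => decide (y < x)

/-- The jeu de taquin operator `𝓕`: slide into the position above the top of the left
column; the result has shape `λ(a+1, b−1, c)`. -/
def Fop : TC → Option TC := fun t =>
  let b := t.1; let L := t.2.1; let R := t.2.2
  if b = 0 then none else
    match (List.range (L.length + 1)).find? (fun i => FCond b L R i) with
    | none => none
    | some i =>
        match R[b - 1 + i]? with
        | some y => some (b - 1, L.take i ++ y :: L.drop i, R.eraseIdx (b - 1 + i))
        | none => none

def ECond (b : ℕ) (L R : List ℕ) (i : ℕ) : Bool :=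
  match L[i]? with
  | none => false
  | some x =>
      if b + i = 0 then true
      else match R[b + i - 1]? with
        | none => true
        | some y => decide (y < x)

/-- The jeu de taquin operator `𝓔`: slide into the position below the bottom of the right
column; the result has shape `λ(a−1, b+1, c)`. -/
def Eop : TC → Option TC := fun t =>
  let b := t.1; let L := t.2.1; let R := t.2.2
  if L.length + b ≤ R.length then none else
    match ((List.range (R.length - b + 1)).reverse).find? (fun i => ECond b L R i) with
    | none => none
    | some i =>
        match L[i]? with
        | some x => some (b + 1, L.eraseIdx i, R.insertIdx (b + i) x)
        | none => none

/-- Iteration of a partial operator. -/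
def iterO {α : Type} (g : α → Option α) : ℕ → α → Option α
  | 0, t => some t
  | k + 1, t => (g t).bind (iterO g k)

/-- Bounded boolean test of two-column semistandardness (overlap part only). -/
def ssdB (b : ℕ) (U V : List ℕ) : Bool :=
  (List.range U.length).all fun i =>
    match U[i]?, V[b + i]? with
    | some x, some y => decide (x ≤ y)
    | _, _ => true

/-- The canonical offset of a pair of columns `(U, V)` (`U` left, `V` right): the least `b`
such that the two-column arrangement with offset `b` is semistandard; this realizes `(U,V)`
as the two-column tableau `T` with `(T^L, T^R) = (U, V)` and `r_T = 0`. -/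
def pairOffset (U V : List ℕ) : ℕ :=
  match (List.range (V.length + 1)).find? (fun b =>
      decide (V.length ≤ U.length + b) && ssdB b U V) with
  | some b => b
  | none => V.length

/-- `𝓕` on a pair of single columns. -/
def pairF (U V : List ℕ) : Option (List ℕ × List ℕ) :=
  (Fop (pairOffset U V, U, V)).map fun t => (t.2.1, t.2.2)

/-- `𝓔` on a pair of single columns. -/
def pairE (U V : List ℕ) : Option (List ℕ × List ℕ) :=
  (Eop (pairOffset U V, U, V)).map fun t => (t.2.1, t.2.2)

/-- `𝓕_i` on a tuple of columns (components listed right-to-left, 0-based index `k = i−1`):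
apply `𝓕` to the pair formed by components `k+1` (left) and `k` (right). -/
def FiOp (k : ℕ) (us : List (List ℕ)) : Option (List (List ℕ)) :=
  match us[k]?, us[k+1]? with
  | some V, some U => (pairF U V).map fun p => (us.set (k+1) p.1).set k p.2
  | _, _ => none

/-- `𝓔_i` on a tuple of columns. -/
def EiOp (k : ℕ) (us : List (List ℕ)) : Option (List (List ℕ)) :=
  match us[k]?, us[k+1]? with
  | some V, some U => (pairE U V).map fun p => (us.set (k+1) p.1).set k p.2
  | _, _ => none

end KN
namespace KN

/-- A seminormal pre-crystal structure on a type `α`, with index set `ℕ`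
(only finitely many indices are relevant in each use). -/
structure PreCrystal (α : Type) where
  eps : α → ℕ → ℤ
  phi : α → ℕ → ℤ
  e : ℕ → α → Option α
  f : ℕ → α → Option α

variable {α : Type}

/-- `ε_i` of a tensor product `b₁ ⊗ b₂ ⊗ ⋯` (list order = tensor order), computed from
the tensor product rule using `⟨wt b, h_i⟩ = φ_i(b) − ε_i(b)`. -/
def listEps (C : PreCrystal α) (i : ℕ) : List α → ℤ
  | [] => 0
  | x :: xs => max (C.eps x i) (listEps C i xs - (C.phi x i - C.eps x i))

def listPhi (C : PreCrystal α) (i : ℕ) : List α → ℤ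
  | [] => 0
  | x :: xs => max (C.phi x i + (listPhi C i xs - listEps C i xs)) (listPhi C i xs)

/-- `ẽ_i` on a tensor product: `ẽ_i(b₁ ⊗ b₂) = ẽ_i b₁ ⊗ b₂` if `φ_i(b₁) ≥ ε_i(b₂)`,
else `b₁ ⊗ ẽ_i b₂`. -/
def listE (C : PreCrystal α) (i : ℕ) : List α → Option (List α)
  | [] => none
  | x :: xs =>
      if listEps C i xs ≤ C.phi x i then (C.e i x).map (· :: xs)
      else (listE C i xs).map (x :: ·)

/-- `f̃_i` on a tensor product: `f̃_i(b₁ ⊗ b₂) = f̃_i b₁ ⊗ b₂` if `φ_i(b₁) > ε_i(b₂)`,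
else `b₁ ⊗ f̃_i b₂`. -/
def listF (C : PreCrystal α) (i : ℕ) : List α → Option (List α)
  | [] => none
  | x :: xs =>
      if listEps C i xs < C.phi x i then (C.f i x).map (· :: xs)
      else (listF C i xs).map (x :: ·)

/-! The one-box crystal of type `C_n`:
`1 → 2 → ⋯ → n → n̄ → ⋯ → 2̄ → 1̄`, with the letter `k` encoded as `k−1` and `k̄` as
`2n−k`; the arrow label `i` ranges over `1 ≤ i ≤ n` (1-based). -/

def boxCe (n i v : ℕ) : Option ℕ :=
  if 1 ≤ i ∧ i < n then
    (if v = i then some (i - 1) else if v + i = 2 * n then some (v - 1) else none)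
  else if i = n then (if v = n then some (n - 1) else none)
  else none

def boxCf (n i v : ℕ) : Option ℕ :=
  if 1 ≤ i ∧ i < n then
    (if v + 1 = i then some i else if v + 1 + i = 2 * n then some (v + 1) else none)
  else if i = n then (if v + 1 = n then some n else none)
  else none

def boxC (n : ℕ) : PreCrystal ℕ where
  eps v i := if (boxCe n i v).isSome then 1 else 0
  phi v i := if (boxCf n i v).isSome then 1 else 0
  e i v := boxCe n i v
  f i v := boxCf n i v

/-- The weight in `ℤ^n` of a letter of `𝕁_n^×` (1-based coordinate `k`):
`wt(k) = ε_k`, `wt(k̄) = −ε_k`. -/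
def wtBox (n v k : ℕ) : ℤ :=
  if v + 1 = k then 1 else if v + k = 2 * n then -1 else 0

def wtList (n : ℕ) (l : List ℕ) (k : ℕ) : ℤ := (l.map fun v => wtBox n v k).sum

/-- Reconstitute a list of columns from its (modified) reading word. -/
def rebuildJoin (cols : List (List ℕ)) (w : List ℕ) : List (List ℕ) :=
  (cols.foldl (fun (st : List (List ℕ) × List ℕ) c =>
      (st.1 ++ [st.2.take c.length], st.2.drop c.length)) ([], w)).1

/-- Crystal operator `ẽ_i` on a tableau given as a list of columns (rightmost first, each
top-to-bottom), via the column reading word. -/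
def tabE (n i : ℕ) (cols : List (List ℕ)) : Option (List (List ℕ)) :=
  (listE (boxC n) i cols.flatten).map (rebuildJoin cols)

def tabF (n i : ℕ) (cols : List (List ℕ)) : Option (List (List ℕ)) :=
  (listF (boxC n) i cols.flatten).map (rebuildJoin cols)

/-- Does a two-column tableau `(L,R)` (pair of columns over `[n̄]`) carry a domino of two
`n̄`'s on its top? -/
def dominoTop (n : ℕ) (p : List ℕ × List ℕ) : Bool :=
  (p.1.head? == some n) && (p.2.head? == some n) && decide (p.2.length ≤ p.1.length)

/-- Can a domino of two `n̄`'s be added on top of a two-column tableau `(L,R)`? -/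
def canDomino (n : ℕ) (p : List ℕ × List ℕ) : Bool :=
  (match p.1.head? with | some x => decide (n < x) | none => true) &&
  (match p.2.head? with | some x => decide (n < x) | none => true) &&
  decide (p.2.length ≤ p.1.length)

/-- The pre-crystal structure on two-column tableaux `(L,R)` over `[n̄]`: for `i < n`
via the column reading word `R ++ L`; for `i = n` by removing/adding an `n̄n̄`-domino
on the top. -/
def pairPC (n : ℕ) : PreCrystal (List ℕ × List ℕ) where
  eps p i := if i = n then (if dominoTop n p then 1 else 0)
             else listEps (boxC n) i (p.2 ++ p.1)
  phi p i := if i = n then (if canDomino n p then 1 else 0)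
             else listPhi (boxC n) i (p.2 ++ p.1)
  e i p := if i = n then (if dominoTop n p then some (p.1.tail, p.2.tail) else none)
           else (listE (boxC n) i (p.2 ++ p.1)).map
              (fun w => (w.drop p.2.length, w.take p.2.length))
  f i p := if i = n then (if canDomino n p then some (n :: p.1, n :: p.2) else none)
           else (listF (boxC n) i (p.2 ++ p.1)).map
              (fun w => (w.drop p.2.length, w.take p.2.length))

end KN
namespace KN

/-- The tableau `~(^R T)`: the increasing column with entries the letters `k ∈ [n]`
(code `k−1`) such that `k̄` (code `2n−k`) does not occur in `^R T`. -/
def compBar (n : ℕ) (RT : List ℕ) : List ℕ :=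
  (List.range n).filter fun j => ! RT.contains (2 * n - 1 - j)

/-- The map `T ↦ T̃` on `T^{c_n}(a)` (shape `λ(a,0,c)`). -/
def tildeMap (n a : ℕ) (p : List ℕ × List ℕ) : List ℕ :=
  match iterO Eop a (0, p.1, p.2) with
  | some t => compBar n t.2.2 ++ t.2.1
  | none => []

/-- The Kashiwara–Nakashima one-column condition of type `C_n` for a column of height
`h`. -/
def KN1 (n h : ℕ) (l : List ℕ) : Prop :=
  ∀ c i₁ i₂, 1 ≤ c → c ≤ n →
    getB l i₁ = some (2 * n - c) → getB l i₂ = some (c - 1) → i₁ < i₂ →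
      i₁ + h + 1 ≤ c + i₂

/-- The set `T^{c_n}(a)`, encoded as pairs of columns `(L, R)` over
`[n̄] = {n,…,2n−1}` forming a semistandard tableau of shape `λ(a,0,c)`. -/
def TCnSet (n a : ℕ) : Set (List ℕ × List ℕ) :=
  {p | p.1.length = p.2.length + a ∧ PairSSD 0 p.1 p.2 ∧
      (∀ x ∈ p.1, n ≤ x ∧ x < 2 * n) ∧ ∀ x ∈ p.2, n ≤ x ∧ x < 2 * n}

/-- The set `KN^{c_n}_{(1^h)}` of KN columns of type `C_n` of height `h`, over
`𝕁_n^× = {1 < ⋯ < n < n̄ < ⋯ < 1̄}` encoded as `{0,…,2n−1}`. -/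
def KNcolC (n h : ℕ) : Set (List ℕ) :=
  {l | l.length = h ∧ l.Chain' (· < ·) ∧ (∀ x ∈ l, x < 2 * n) ∧ KN1 n h l}

/-- The inverse map `Ψ_a`: split a KN column `T` into its barred part `T₋` and the barred
complement `~T₊` of its unbarred part, and apply `𝓕^{n−a}`. -/
def PsiCol (n : ℕ) (T : List ℕ) : List ℕ × List ℕ :=
  let U := T.filter fun x => decide (n ≤ x)
  let V := (List.range n).filterMap fun j =>
    let k := n - j
    if T.contains (k - 1) then none else some (2 * n - k)
  match iterO Fop (n - T.length) (pairOffset U V, U, V) with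
  | some t => (t.2.1, t.2.2)
  | none => ([], [])

end KN


namespace KN

set_option linter.unusedSimpArgs false
set_option linter.unusedVariables false

/-! ### Words in four letters -/

/-- The increasing list of positions of `true` (starting at `k`). -/
def dec : ℕ → List Bool → List ℕ
  | _, [] => []
  | k, true :: bs => k :: dec (k + 1) bs
  | k, false :: bs => dec (k + 1) bs

theorem dec_append (k : ℕ) (P Q : List Bool) :
    dec k (P ++ Q) = dec k P ++ dec (k + P.length) Q := by
  induction P generalizing k with
  | nil => simp [dec]
  | cons b P ih =>
    cases b <;> simp [dec, ih, Nat.add_assoc, Nat.add_comm 1]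

theorem dec_length (k : ℕ) (P : List Bool) : (dec k P).length = P.count true := by
  induction P generalizing k with
  | nil => simp [dec]
  | cons b P ih => cases b <;> simp [dec, ih]

theorem mem_dec (k : ℕ) (P : List Bool) (x : ℕ) :
    x ∈ dec k P ↔ k ≤ x ∧ P[x - k]? = some true := by
  induction P generalizing k with
  | nil => simp [dec]
  | cons b P ih =>
    rcases Nat.lt_trichotomy x k with h | h | h
    · cases b <;> simp [dec, ih] <;> omega
    · subst h
      cases b <;> simp [dec, ih]
    · have : x - k = (x - (k + 1)) + 1 := by omega
      cases b <;> simp [dec, ih, this] <;> grind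

theorem dec_range (k : ℕ) (P : List Bool) (x : ℕ) (h : x ∈ dec k P) :
    k ≤ x ∧ x < k + P.length := by
  rw [mem_dec] at h
  refine ⟨h.1, ?_⟩
  have := (List.getElem?_eq_some_iff.1 h.2).1
  omega

theorem dec_pairwise (k : ℕ) (P : List Bool) : (dec k P).Pairwise (· < ·) := by
  induction P generalizing k with
  | nil => simp [dec]
  | cons b P ih =>
    cases b
    · simpa [dec] using ih (k + 1)
    · simp only [dec, List.pairwise_cons]
      exact ⟨fun x hx => (dec_range _ _ _ hx).1, ih _⟩

theorem exists_dec (n s : ℕ) (l : List ℕ) (hl : l.Pairwise (· < ·))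
    (hr : ∀ x ∈ l, s ≤ x ∧ x < s + n) : ∃ P : List Bool, P.length = n ∧ dec s P = l := by
  induction n generalizing s l with
  | zero =>
    refine ⟨[], rfl, ?_⟩
    cases l with
    | nil => rfl
    | cons x t => have := hr x (by simp); omega
  | succ n ih =>
    cases l with
    | nil =>
      obtain ⟨P, h1, h2⟩ := ih (s + 1) [] (by simp) (by simp)
      exact ⟨false :: P, by simp [h1], by simp [dec, h2]⟩
    | cons x t =>
      rw [List.pairwise_cons] at hl
      by_cases hx : x = s
      · obtain ⟨P, h1, h2⟩ := ih (s + 1) t hl.2 (fun y hy => by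
          have := hl.1 y hy
          have := hr y (by simp [hy])
          omega)
        exact ⟨true :: P, by simp [h1], by simp [dec, h2, hx]⟩
      · have hxs := hr x (by simp)
        obtain ⟨P, h1, h2⟩ := ih (s + 1) (x :: t) (List.pairwise_cons.2 hl) (fun y hy => by
          have := hr y hy
          rcases List.mem_cons.1 hy with h | h
          · omega
          · have := hl.1 y h
            omega)
        exact ⟨false :: P, by simp [h1], by simp [dec, h2]⟩

theorem dec_inj (k : ℕ) (P Q : List Bool) (hl : P.length = Q.length)
    (h : dec k P = dec k Q) : P = Q := by
  apply List.ext_getElem? 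
  intro i
  have hi : k + i ∈ dec k P ↔ k + i ∈ dec k Q := by rw [h]
  simp only [mem_dec] at hi
  by_cases hP : i < P.length
  · have hQ : i < Q.length := hl ▸ hP
    simp [hP, hQ] at hi ⊢
    exact hi
  · have hQ : ¬ i < Q.length := hl ▸ hP
    rw [List.getElem?_eq_none (by omega), List.getElem?_eq_none (by omega)]

theorem pw_ext (l m : List ℕ) (hl : l.Pairwise (· < ·)) (hm : m.Pairwise (· < ·))
    (h : ∀ x, x ∈ l ↔ x ∈ m) : l = m := by
  refine List.Perm.eq_of_pairwise (le := (· < ·)) (fun a b _ _ h1 h2 => by omega) hl hm ?_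
  rw [List.perm_ext_iff_of_nodup]
  · exact h
  · exact hl.imp (fun h => Nat.ne_of_lt h)
  · exact hm.imp (fun h => Nat.ne_of_lt h)

theorem compBar_dec (n : ℕ) (r : List Bool) (hr : r.length = n) :
    compBar n (dec n r) = dec 0 ((r.map (fun b => !b)).reverse) := by
  apply pw_ext
  · exact List.Pairwise.filter _ List.pairwise_lt_range
  · exact dec_pairwise _ _
  · intro x
    simp only [compBar, List.mem_filter, List.mem_range, mem_dec, Nat.zero_le, true_and,
      Nat.sub_zero, Bool.not_eq_true', List.contains_eq_mem, decide_eq_false_iff_not]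
    by_cases hx : x < n
    · rw [List.getElem?_reverse (by simpa [hr] using hx)]
      have : 2 * n - 1 - x - n = r.length - 1 - x := by omega
      have h2 : r.length - 1 - x < r.length := by omega
      simp [this, hx, h2]
      omega
    · rw [List.getElem?_eq_none (l := (r.map (fun b => !b)).reverse) (by simp [hr]; omega)]
      simp [hx]

/-- Position of an entry versus its value. -/
theorem dec_lt_iff (k : ℕ) (P Q : List Bool) (i x : ℕ) (h : (dec k (P ++ Q))[i]? = some x) :
    x < k + P.length ↔ i < P.count true := by
  rw [dec_append] at h
  rw [← dec_length k P]
  by_cases hi : i < (dec k P).length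
  · rw [List.getElem?_append_left hi] at h
    have := dec_range k P x (List.mem_of_getElem? h)
    simp [hi, this]
  · rw [List.getElem?_append_right (by omega)] at h
    have := dec_range _ Q x (List.mem_of_getElem? h)
    omega

theorem dec_split (k : ℕ) (P Q : List Bool) (b : Bool) :
    dec k (P ++ b :: Q) = dec k P ++ ((if b then [k + P.length] else []) ++
      dec (k + P.length + 1) Q) := by
  cases b <;> simp [dec_append, dec]

theorem getB_dec (k : ℕ) (P Q : List Bool) (b : Bool) (i : ℕ) :
    getB (dec k (P ++ b :: Q)) i = some (k + P.length) ↔ b = true ∧ i = Q.count true + 1 := by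
  have hlen : (dec k (P ++ b :: Q)).length = P.count true + (if b then 1 else 0) + Q.count true := by
    rw [dec_length]; cases b <;> simp <;> omega
  unfold getB
  constructor
  · intro h
    split_ifs at h with hi
    have h1 := dec_lt_iff k P (b :: Q) _ _ h
    have h2 := dec_lt_iff k (P ++ [b]) Q ((dec k (P ++ b :: Q)).length - i) (k + P.length)
      (by simpa using h)
    rw [hlen] at h1 h2 hi
    cases b
    · simp at h1 h2 hi
      omega
    · simp only [if_true, List.count_append, List.count_singleton_self, List.length_append,
        List.length_singleton] at h1 h2 hi
      simp only [true_and]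
      omega
  · rintro ⟨rfl, rfl⟩
    rw [if_pos (by rw [hlen, if_pos rfl]; omega), hlen, dec_split]
    rw [List.getElem?_append_right (by rw [dec_length]; simp; omega), dec_length]
    have : List.count true P + (if true = true then 1 else 0) + List.count true Q -
      (List.count true Q + 1) - List.count true P = 0 := by simp; omega
    rw [this]
    simp

abbrev Let := Bool × Bool

def nd1 : Let → ℕ → ℕ
  | (true, false), k => k - 1
  | (false, true), k => k + 1
  | _, k => k

def need (k : ℕ) : List Let → ℕ
  | [] => k
  | x :: w => nd1 x (need k w)

def tl1 : Let → ℕ → Let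
  | (true, false), 0 => (false, true)
  | x, _ => x

def tl (k : ℕ) : List Let → List Let
  | [] => []
  | x :: w => tl1 x (need k w) :: tl k w

def un1 : Let → ℕ → ℕ
  | (true, false), 0 => 1
  | _, _ => 0

def un : List Let → ℕ
  | [] => 0
  | x :: w => un w + un1 x (need 0 w)

def inv1 : Let → ℕ → Let
  | (false, true), 0 => (true, false)
  | x, _ => x

def nx1 : Let → ℕ → ℕ
  | (true, false), d => d + 1
  | (false, true), d => d - 1
  | _, d => d

def inv : ℕ → List Let → List Let
  | _, [] => []
  | d, x :: w => inv1 x d :: inv (nx1 x d) w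

def cl (w : List Let) : ℕ := (w.map Prod.fst).count true
def cr (w : List Let) : ℕ := (w.map Prod.snd).count true

theorem cl_nil : cl [] = 0 := rfl
theorem cr_nil : cr [] = 0 := rfl
theorem cl_cons (x : Let) (w) : cl (x :: w) = cl w + (if x.1 then 1 else 0) := by
  simp [cl, List.count_cons]
theorem cr_cons (x : Let) (w) : cr (x :: w) = cr w + (if x.2 then 1 else 0) := by
  simp [cr, List.count_cons]
theorem cl_append (v w) : cl (v ++ w) = cl v + cl w := by simp [cl]
theorem cr_append (v w) : cr (v ++ w) = cr v + cr w := by simp [cr]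
theorem cr_le (w) : cr w ≤ w.length := by
  unfold cr
  exact le_trans List.count_le_length (by simp)

def sc : List Let → Prop
  | [] => True
  | x :: w => sc w ∧ (x = (true, false) → cl w + 1 ≤ cr w)

theorem need_append (k v w) : need k (v ++ w) = need (need k w) v := by
  induction v with
  | nil => rfl
  | cons x v ih => simp [need, ih]

theorem tl_append (k v w) : tl k (v ++ w) = tl (need k w) v ++ tl k w := by
  induction v with
  | nil => rfl
  | cons x v ih => simp [tl, ih, need_append]

theorem tl_length (k w) : (tl k w).length = w.length := by
  induction w with
  | nil => rfl
  | cons x v ih => simp [tl, ih]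

theorem inv_length (k w) : (inv k w).length = w.length := by
  induction w generalizing k with
  | nil => rfl
  | cons x v ih => simp [inv, ih]

theorem un_need (w) : cl w + need 0 w = cr w + un w := by
  induction w with
  | nil => rfl
  | cons x w ih =>
    obtain ⟨_ | _, _ | _⟩ := x <;> simp [cl_cons, cr_cons, un, need, nd1, un1] <;>
      (try omega)
    rcases h : need 0 w with _ | k <;> simp [un1] <;> omega

theorem cl_tl (w) : cl (tl 0 w) + un w = cl w := by
  induction w with
  | nil => rfl
  | cons x w ih =>
    obtain ⟨_ | _, _ | _⟩ := x <;> simp [cl_cons, tl, tl1, un, un1] <;> (try omega)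
    rcases h : need 0 w with _ | k <;> simp [un1, tl1] <;> omega

theorem cr_tl (w) : cr (tl 0 w) = cr w + un w := by
  induction w with
  | nil => rfl
  | cons x w ih =>
    obtain ⟨_ | _, _ | _⟩ := x <;> simp [cr_cons, tl, tl1, un, un1] <;> (try omega)
    rcases h : need 0 w with _ | k <;> simp [un1, tl1] <;> omega

theorem inv_tl (w) : inv (need 0 w) (tl 0 w) = w := by
  induction w with
  | nil => rfl
  | cons x w ih =>
    obtain ⟨_ | _, _ | _⟩ := x <;> simp [need, tl, nd1, tl1, inv, inv1, nx1] <;> (try exact ih)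
    rcases h : need 0 w with _ | k <;> rw [h] at ih <;> simp [tl1, inv1, nx1, ih]

theorem sc_le (w) (h : sc w) : cl w ≤ cr w := by
  induction w with
  | nil => exact le_rfl
  | cons x w ih =>
    obtain ⟨_ | _, _ | _⟩ := x <;> simp [sc, cl_cons, cr_cons] at h ⊢ <;>
      (first | have := ih h | have := ih h.1) <;> omega

theorem need_inv (w) (d) (h : sc w) (hd : cl w + d ≤ cr w) :
    need 0 (inv d w) = d ∧ tl 0 (inv d w) = w := by
  induction w generalizing d with
  | nil => simp [cl_nil, cr_nil] at hd; simp [need, inv, tl, hd]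
  | cons x w ih =>
    obtain ⟨_ | _, _ | _⟩ := x <;> simp [sc, cl_cons, cr_cons] at h hd
    · obtain ⟨h1, h2⟩ := ih d h hd
      simp [inv, need, inv1, nx1, nd1, tl, tl1, h1, h2]
    · have hle := sc_le w h
      obtain ⟨h1, h2⟩ := ih (d - 1) h (by omega)
      rcases d with _ | d
      · simp at h1 h2
        simp [inv, need, inv1, nx1, nd1, tl, tl1, h1, h2]
      · simp at h1 h2
        simp [inv, need, inv1, nx1, nd1, tl, tl1, h1, h2]
    · obtain ⟨h1, h2⟩ := ih (d + 1) h.1 (by omega)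
      simp [inv, need, inv1, nx1, nd1, tl, tl1, h1, h2]
    · obtain ⟨h1, h2⟩ := ih d h (by omega)
      simp [inv, need, inv1, nx1, nd1, tl, tl1, h1, h2]

theorem sc_tl (w) : sc (tl 0 w) := by
  induction w with
  | nil => trivial
  | cons x w ih =>
    obtain ⟨_ | _, _ | _⟩ := x <;> simp [sc, tl, tl1, ih]
    have h1 := cl_tl w
    have h2 := cr_tl w
    have h3 := un_need w
    rcases h : need 0 w with _ | k <;> simp [tl1]
    omega

theorem need_pre_le (P Q) : cr P ≤ cl P + need 0 (P ++ Q) := by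
  induction P with
  | nil => simp [cr_nil]
  | cons x w ih =>
    obtain ⟨_ | _, _ | _⟩ := x <;> simp [need, nd1, cl_cons, cr_cons] <;> omega

theorem need_le (w) (d) (h : ∀ P Q, w = P ++ Q → cr P ≤ cl P + d) : need 0 w ≤ d := by
  induction w generalizing d with
  | nil => simp [need]
  | cons x w ih =>
    obtain ⟨_ | _, _ | _⟩ := x
    · simp only [need, nd1]
      refine ih d fun P Q hw => ?_
      have := h ((false, false) :: P) Q (by simp [hw])
      simpa [cl_cons, cr_cons] using this
    · simp only [need, nd1]
      have h0 := h [(false, true)] w (by simp)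
      simp [cl_cons, cr_cons, cl_nil, cr_nil] at h0
      have := ih (d - 1) fun P Q hw => by
        have := h ((false, true) :: P) Q (by simp [hw])
        simp [cl_cons, cr_cons] at this
        omega
      omega
    · simp only [need, nd1]
      have := ih (d + 1) fun P Q hw => by
        have := h ((true, false) :: P) Q (by simp [hw])
        simp [cl_cons, cr_cons] at this
        omega
      omega
    · simp only [need, nd1]
      refine ih d fun P Q hw => ?_
      have := h ((true, true) :: P) Q (by simp [hw])
      simp [cl_cons, cr_cons] at this
      omega

theorem insertIdx_len (l m : List ℕ) (x : ℕ) : (l ++ m).insertIdx l.length x = l ++ x :: m := by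
  induction l with
  | nil => simp
  | cons y l ih => simp [ih]

def wl (w : List Let) : List Bool := w.map Prod.fst
def wr (w : List Let) : List Bool := w.map Prod.snd

theorem Eop_step (n b : ℕ) (A B : List Let) (hA : cr A = cl A + b) (hB : need 0 B = 0) :
    Eop (b, dec n (wl (A ++ (true, false) :: B)), dec n (wr (A ++ (true, false) :: B))) =
      some (b + 1, dec n (wl (A ++ (false, true) :: B)), dec n (wr (A ++ (false, true) :: B))) := by
  have hBB := need_pre_le B []
  simp only [List.append_nil, hB, Nat.add_zero] at hBB
  have hL : (dec n (wl (A ++ (true, false) :: B))).length = cl A + 1 + cl B := by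
    rw [dec_length]; simp [wl, cl]; omega
  have hR : (dec n (wr (A ++ (true, false) :: B))).length = cr A + cr B := by
    rw [dec_length]; simp [wr, cr]
  have hLi : (dec n (wl (A ++ (true, false) :: B)))[cl A]? = some (n + A.length) := by
    have : wl (A ++ (true, false) :: B) = wl A ++ true :: wl B := by simp [wl]
    rw [this, dec_split, List.getElem?_append_right (by simp [dec_length, cl, wl])]
    simp [dec_length, cl, wl]
  have hC1 : ECond b (dec n (wl (A ++ (true, false) :: B))) (dec n (wr (A ++ (true, false) :: B)))
      (cl A) = true := by
    unfold ECond
    simp only [hLi]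
    split_ifs with h0
    · rfl
    · split
      · rfl
      · rename_i y hy
        simp only [decide_eq_true_eq]
        have h1 : wr (A ++ (true, false) :: B) = wr A ++ wr ((true, false) :: B) := by simp [wr]
        rw [h1] at hy
        have := (dec_lt_iff n (wr A) _ _ _ hy)
        have h2 : (wr A).count true = cr A := rfl
        have h3 : (wr A).length = A.length := by simp [wr]
        rw [h2, h3] at this
        rw [this]; omega
  have hC2 : ∀ i, cl A < i → i ≤ cr A + cr B - b →
      ECond b (dec n (wl (A ++ (true, false) :: B))) (dec n (wr (A ++ (true, false) :: B)))
        i = false := by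
    intro i h1 h2
    unfold ECond
    split
    · rfl
    · rename_i x hx
      rw [if_neg (by omega)]
      have hlt : b + i - 1 < (dec n (wr (A ++ (true, false) :: B))).length := by omega
      rw [List.getElem?_eq_getElem hlt]
      simp only [decide_eq_false_iff_not]
      intro hyx
      set y := (dec n (wr (A ++ (true, false) :: B)))[b + i - 1] with hy
      have hy' : (dec n (wr (A ++ (true, false) :: B)))[b + i - 1]? = some y := by
        rw [List.getElem?_eq_getElem hlt]
      -- the initial segment of length `y + 1 - n`
      have hyn : n + A.length ≤ y := by
        have h1 : wr (A ++ (true, false) :: B) = wr A ++ wr ((true, false) :: B) := by simp [wr]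
        rw [h1] at hy'
        have := (dec_lt_iff n (wr A) _ _ _ hy')
        have h2 : (wr A).count true = cr A := rfl
        have h3 : (wr A).length = A.length := by simp [wr]
        rw [h2, h3] at this
        omega
      have hyn2 := dec_range _ _ _ (List.mem_of_getElem? hy')
      have hlen : (wr (A ++ (true, false) :: B)).length = A.length + 1 + B.length := by
        simp [wr]; omega
      rw [hlen] at hyn2
      set m := y - (n + A.length) with hm
      -- this initial segment in terms of the word
      have hs : A ++ (true, false) :: B = (A ++ (true, false) :: B.take m) ++ B.drop m := by
        simp
      have hpl : (A ++ (true, false) :: B.take m).length = A.length + 1 + m := by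
        simp; omega
      have e1 : wr (A ++ (true, false) :: B) =
          wr (A ++ (true, false) :: B.take m) ++ wr (B.drop m) := by
        rw [wr, wr, wr, ← List.map_append, ← hs]
      have e2 : wl (A ++ (true, false) :: B) =
          wl (A ++ (true, false) :: B.take m) ++ wl (B.drop m) := by
        rw [wl, wl, wl, ← List.map_append, ← hs]
      rw [e1] at hy'
      rw [e2] at hx
      have f1 := dec_lt_iff n _ _ _ _ hy'
      have f2 := dec_lt_iff n _ _ _ _ hx
      have g1 : (wr (A ++ (true, false) :: B.take m)).count true = cr A + cr (B.take m) := by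
        simp [wr, cr]
      have g2 : (wl (A ++ (true, false) :: B.take m)).count true = cl A + 1 + cl (B.take m) := by
        simp [wl, cl]; omega
      have g3 : (wr (A ++ (true, false) :: B.take m)).length = A.length + 1 + m := by
        rw [wr, List.length_map, hpl]
      have g4 : (wl (A ++ (true, false) :: B.take m)).length = A.length + 1 + m := by
        rw [wl, List.length_map, hpl]
      rw [g1, g3] at f1
      rw [g2, g4] at f2
      have := need_pre_le (B.take m) (B.drop m)
      rw [List.take_append_drop, hB] at this
      omega
  have hfind : ((List.range ((dec n (wr (A ++ (true, false) :: B))).length - b + 1)).reverse).find?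
      (fun i => ECond b (dec n (wl (A ++ (true, false) :: B)))
        (dec n (wr (A ++ (true, false) :: B))) i) = some (cl A) := by
    rw [hR]
    have : cr A + cr B - b + 1 = cl A + 1 + cr B := by omega
    rw [this, List.range_add, List.reverse_append, List.find?_append, List.find?_eq_none.2]
    · rw [List.range_succ, List.reverse_append]
      simp [hC1]
    · intro x hx
      simp only [List.mem_reverse, List.mem_map, List.mem_range] at hx
      obtain ⟨j, hj, rfl⟩ := hx
      rw [hC2 _ (by omega) (by omega)]
      simp
  unfold Eop
  simp only
  rw [if_neg (by omega), hfind]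
  simp only [hLi, Option.some.injEq, Prod.mk.injEq, true_and]
  constructor
  · have a1 : wl (A ++ (true, false) :: B) = wl A ++ true :: wl B := by simp [wl]
    have a2 : wl (A ++ (false, true) :: B) = wl A ++ false :: wl B := by simp [wl]
    have a3 : cl A = (dec n (wl A)).length := by rw [dec_length]; rfl
    rw [a1, a2, dec_split, dec_split, a3, List.eraseIdx_append_of_length_le le_rfl]
    simp
  · have a1 : wr (A ++ (true, false) :: B) = wr A ++ false :: wr B := by simp [wr]
    have a2 : wr (A ++ (false, true) :: B) = wr A ++ true :: wr B := by simp [wr]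
    have a3 : b + cl A = (dec n (wr A)).length := by rw [dec_length, add_comm, ← hA]; rfl
    have a4 : A.length = (wr A).length := by simp [wr]
    rw [a1, a2, dec_split, dec_split, a3, insertIdx_len, a4]
    simp

theorem iter_Eop (n b : ℕ) (A W : List Let) (h : cr A + need 0 W = cl A + b) :
    iterO Eop (un W) (b, dec n (wl (A ++ W)), dec n (wr (A ++ W))) =
      some (b + un W, dec n (wl (A ++ tl 0 W)), dec n (wr (A ++ tl 0 W))) := by
  induction W generalizing A b with
  | nil => simp [un, iterO, tl]
  | cons x w ih =>
    by_cases hx : x = (true, false) ∧ need 0 w = 0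
    · obtain ⟨rfl, h0⟩ := hx
      simp only [need, nd1, h0] at h
      simp only [un, h0, un1, tl, tl1, iterO]
      rw [Eop_step n b A w (by omega) h0]
      simp only [Option.bind_some]
      have := ih (b + 1) (A ++ [(false, true)])
        (by simp [cr_append, cl_append, cr_cons, cl_cons, cl_nil, cr_nil]; omega)
      simp only [List.append_assoc, List.singleton_append] at this
      rw [this]
      simp; omega
    · have h1 : un1 x (need 0 w) = 0 ∧ tl1 x (need 0 w) = x := by
        obtain ⟨_ | _, _ | _⟩ := x <;> simp [un1, tl1] at hx ⊢
        rcases hh : need 0 w with _ | k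
        · exact absurd hh hx
        · simp [un1, tl1]
      simp only [un, tl, h1, Nat.add_zero]
      have := ih b (A ++ [x]) (by
        simp only [cr_append, cl_append, cr_cons, cl_cons, cl_nil, cr_nil]
        obtain ⟨_ | _, _ | _⟩ := x <;> simp [need, nd1] at h hx ⊢ <;> omega)
      simp only [List.append_assoc, List.singleton_append] at this
      exact this

def pr (n : ℕ) (W : List Let) : List ℕ × List ℕ := (dec n (wl W), dec n (wr W))

def tw (W : List Let) : List ℕ := dec 0 ((wr W).map (fun b => !b)).reverse ++ dec W.length (wl W)

theorem tilde_pr (n : ℕ) (W : List Let) (hn : W.length = n) (h : need 0 W = 0) :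
    tildeMap n (un W) (pr n W) = tw (tl 0 W) := by
  have := iter_Eop n 0 [] W (by simp [cr_nil, cl_nil, h])
  simp only [List.nil_append] at this
  unfold tildeMap pr
  simp only [this]
  rw [compBar_dec _ _ (by simp [wr, tl_length, hn]), tw, tl_length, hn]

theorem mem_TCn (n a : ℕ) (W : List Let) (hn : W.length = n) :
    pr n W ∈ TCnSet n a ↔ need 0 W = 0 ∧ un W = a := by
  have hL : (dec n (wl W)).length = cl W := by rw [dec_length]; rfl
  have hR : (dec n (wr W)).length = cr W := by rw [dec_length]; rfl
  have hun := un_need W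
  have key : ∀ P Q, W = P ++ Q → wl W = wl P ++ wl Q ∧ wr W = wr P ++ wr Q ∧
      (wl P).count true = cl P ∧ (wr P).count true = cr P ∧ (wl P).length = P.length ∧
      (wr P).length = P.length := by
    rintro P Q rfl
    simp [wl, wr, cl, cr]
  constructor
  · rintro ⟨h1, ⟨-, -, h2⟩, -, -⟩
    simp only [pr, hL, hR] at h1 h2
    have : need 0 W ≤ 0 := by
      apply need_le
      intro P Q hW
      by_contra hlt
      obtain ⟨k1, k2, k3, k4, k5, k6⟩ := key P Q hW
      have hr : cr P ≤ cr W := by rw [hW, cr_append]; omega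
      have i1 : cl P < (dec n (wr W)).length := by omega
      have i2 : cl P < (dec n (wl W)).length := by omega
      have j1 := List.getElem?_eq_getElem i1
      have j2 := List.getElem?_eq_getElem i2
      have h3 := h2 (cl P) _ _ j2 (by rw [Nat.zero_add]; exact j1)
      generalize (dec n (wr W))[cl P] = y at *
      generalize (dec n (wl W))[cl P] = x at *
      rw [k1] at j2
      rw [k2] at j1
      have m1 := dec_lt_iff _ _ _ _ _ j1
      have m2 := dec_lt_iff _ _ _ _ _ j2
      rw [k4, k6] at m1
      rw [k3, k5] at m2
      omega
    omega
  · rintro ⟨h1, h2⟩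
    refine ⟨by simp only [pr, hL, hR]; omega, ⟨?_, ?_, ?_⟩, ?_, ?_⟩
    · exact List.isChain_iff_pairwise.2 (dec_pairwise _ _)
    · exact List.isChain_iff_pairwise.2 (dec_pairwise _ _)
    · intro i x y hx hy
      simp only [pr, Nat.zero_add] at hx hy
      by_contra hlt
      have hyr := dec_range _ _ _ (List.mem_of_getElem? hy)
      obtain ⟨k1, k2, k3, k4, k5, k6⟩ := key (W.take (y + 1 - n)) (W.drop (y + 1 - n)) (by simp)
      have hp := need_pre_le (W.take (y + 1 - n)) (W.drop (y + 1 - n))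
      have hwl : (wr W).length = W.length := by simp [wr]
      have hlen : (W.take (y + 1 - n)).length = y + 1 - n := by
        rw [List.length_take]; omega
      rw [List.take_append_drop, h1] at hp
      rw [k1] at hx
      rw [k2] at hy
      have m1 := dec_lt_iff _ _ _ _ _ hy
      have m2 := dec_lt_iff _ _ _ _ _ hx
      rw [k4, k6, hlen] at m1
      rw [k3, k5, hlen] at m2
      omega
    · intro x hx
      have := dec_range _ _ _ hx
      simp [wl] at this
      omega
    · intro x hx
      have := dec_range _ _ _ hx
      simp [wr] at this
      omega

theorem zip_wl (P Q : List Bool) (h : P.length = Q.length) : wl (P.zip Q) = P := by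
  simp [wl, List.map_fst_zip, h]

theorem zip_wr (P Q : List Bool) (h : P.length = Q.length) : wr (P.zip Q) = Q := by
  simp [wr, List.map_snd_zip, h]

theorem exists_word (n a : ℕ) (p) (hp : p ∈ TCnSet n a) :
    ∃ W : List Let, W.length = n ∧ p = pr n W ∧ need 0 W = 0 ∧ un W = a := by
  obtain ⟨P, hP, hP'⟩ := exists_dec n n p.1 (List.isChain_iff_pairwise.1 hp.2.1.1)
    (fun x hx => by have := hp.2.2.1 x hx; omega)
  obtain ⟨Q, hQ, hQ'⟩ := exists_dec n n p.2 (List.isChain_iff_pairwise.1 hp.2.1.2.1)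
    (fun x hx => by have := hp.2.2.2 x hx; omega)
  have hl : (P.zip Q).length = n := by simp [hP, hQ]
  have he : p = pr n (P.zip Q) := by
    rw [pr, zip_wl _ _ (by omega), zip_wr _ _ (by omega), hP', hQ']
  refine ⟨P.zip Q, hl, he, ?_⟩
  rw [he] at hp
  exact (mem_TCn n a _ hl).1 hp

theorem tw_eq (W : List Let) :
    tw W = dec 0 (((wr W).map (fun b => !b)).reverse ++ wl W) := by
  rw [dec_append, tw]
  simp [wr]

theorem tw_inj (V W : List Let) (hl : V.length = W.length) (h : tw V = tw W) : V = W := by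
  rw [tw_eq, tw_eq] at h
  have := dec_inj _ _ _ (by simp [wr, wl, hl]) h
  have := List.append_inj this (by simp [wr, hl])
  obtain ⟨h1, h2⟩ := this
  have h3 : wr V = wr W := by
    have h3 := List.reverse_injective h1
    exact List.map_injective_iff.2 (fun a b hab => by simpa using hab) h3
  have e : ∀ U : List Let, U = (wl U).zip (wr U) := by
    intro U
    induction U with
    | nil => rfl
    | cons x U ih => simp only [wl, wr, List.map_cons, List.zip_cons_cons] at ih ⊢; rw [← ih]
  rw [e V, e W, h2, h3]

theorem count_not (w : List Let) : ((wr w).map (fun b => !b)).count true + cr w = w.length := by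
  induction w with
  | nil => rfl
  | cons x w ih =>
    obtain ⟨_ | _, _ | _⟩ := x <;> simp [wr, cr] at ih ⊢ <;> omega

theorem tw_length (W : List Let) : (tw W).length + cr W = W.length + cl W := by
  have := count_not W
  have h2 : (wl W).count true = cl W := rfl
  rw [tw_eq, dec_length, List.count_append, List.count_reverse, h2]
  omega

theorem sc_iff (W : List Let) : sc W ↔ ∀ A B, W = A ++ (true, false) :: B → cl B + 1 ≤ cr B := by
  induction W with
  | nil => simp [sc]
  | cons x w ih =>
    rw [sc, ih]
    constructor
    · rintro ⟨h1, h2⟩ A B h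
      cases A with
      | nil => simp at h; obtain ⟨rfl, rfl⟩ := h; exact h2 rfl
      | cons z A => simp at h; exact h1 A B h.2
    · intro h
      refine ⟨fun A B hw => h (x :: A) B (by simp [hw]), ?_⟩
      rintro rfl
      exact h [] w rfl

theorem KN1_iff (n : ℕ) (W : List Let) (hn : W.length = n) :
    KN1 n (tw W).length (tw W) ↔ sc W := by
  have key : ∀ A (x : Let) B, W = A ++ x :: B →
      (∀ i, getB (tw W) i = some (n + A.length) ↔ x.1 = true ∧ i = cl B + 1) ∧
      (∀ i, getB (tw W) i = some B.length ↔
        x.2 = false ∧ i + ((wr B).map (fun b => !b)).count true = (tw W).length) := by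
    rintro A x B hW
    constructor
    · intro i
      have : tw W = dec 0 ((((wr W).map (fun b => !b)).reverse ++ wl A) ++ x.1 :: wl B) := by
        rw [tw_eq, hW]; simp [wl]
      have hc : cl B = (wl B).count true := rfl
      have h2 := getB_dec 0 (((wr W).map (fun b => !b)).reverse ++ wl A) (wl B) x.1 i
      have h3 : (((wr W).map (fun b => !b)).reverse ++ wl A).length = n + A.length := by
        simp [wr, wl, hn]
      rw [this, hc, ← h2, h3, Nat.zero_add]
    · intro i
      have : tw W = dec 0 (((wr B).map (fun b => !b)).reverse ++ (!x.2) ::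
          (((wr A).map (fun b => !b)).reverse ++ wl W)) := by
        rw [tw_eq, hW]; simp [wr]
      have h2 := getB_dec 0 (((wr B).map (fun b => !b)).reverse)
        (((wr A).map (fun b => !b)).reverse ++ wl W) (!x.2) i
      have h3 : ((wr B).map (fun b => !b)).reverse.length = B.length := by simp [wr]
      rw [h3, Nat.zero_add, ← this] at h2
      rw [h2]
      have hl : (tw W).length = ((wr B).map (fun b => !b)).count true + (if x.2 then 0 else 1) +
          ((((wr A).map (fun b => !b)).reverse ++ wl W)).count true := by
        rw [this, dec_length, List.count_append, List.count_cons, List.count_reverse]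
        cases x.2 <;> simp <;> omega
      rw [hl]
      cases x.2
      · simp only [Bool.not_false, true_and, Bool.false_eq_true, if_false]
        omega
      · simp
  rw [sc_iff]
  constructor
  · intro h A B hW
    obtain ⟨k1, k2⟩ := key A _ B hW
    have hlen : A.length + 1 + B.length = n := by rw [← hn, hW]; simp; omega
    have hc := count_not B
    have hi2 : ((wr B).map (fun b => !b)).count true + cl B + 2 ≤ (tw W).length := by
      have : tw W = dec 0 (((wr W).map (fun b => !b)).reverse ++ wl W) := tw_eq W
      rw [this, dec_length, hW]
      simp [wr, wl, cl]
      omega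
    have := h (B.length + 1) (cl B + 1)
      ((tw W).length - ((wr B).map (fun b => !b)).count true) (by omega) (by omega)
      (by rw [show 2 * n - (B.length + 1) = n + A.length by omega, k1]; simp)
      (by rw [show B.length + 1 - 1 = B.length by omega, k2]; simp only [true_and]; omega)
      (by omega)
    omega
  · intro h c i₁ i₂ h1 h2 h3 h4 h5
    have hd : W = W.take (n - c) ++ W[n - c]'(by omega) :: W.drop (n - c + 1) := by
      simp
    generalize hx : W[n - c]'(by omega) = x at hd
    have hA : (W.take (n - c)).length = n - c := by rw [List.length_take]; omega
    have hB : (W.drop (n - c + 1)).length = c - 1 := by rw [List.length_drop]; omega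
    generalize W.take (n - c) = A at *
    generalize W.drop (n - c + 1) = B at *
    obtain ⟨k1, k2⟩ := key A x B hd
    rw [show 2 * n - c = n + A.length by omega, k1] at h3
    rw [← hB, k2] at h4
    have hxx : x = (true, false) := Prod.ext h3.1 h4.1
    subst hxx
    have := h A B hd
    have hc := count_not B
    omega

/-! ### Crystal operators -/

def Neu (n i : ℕ) (u : List ℕ) : Prop := ∀ x ∈ u, boxCe n i x = none ∧ boxCf n i x = none

theorem eps_box_nonneg (n i x : ℕ) : 0 ≤ (boxC n).eps x i := by
  simp only [boxC]; split_ifs <;> simp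

theorem listEps_nonneg (n i : ℕ) (w : List ℕ) : 0 ≤ listEps (boxC n) i w := by
  cases w with
  | nil => simp [listEps]
  | cons x w => exact le_max_of_le_left (eps_box_nonneg n i x)

theorem listE_none (n i : ℕ) (w : List ℕ) (h : listEps (boxC n) i w ≤ 0) :
    listE (boxC n) i w = none := by
  cases w with
  | nil => rfl
  | cons x w =>
    have h1 := eps_box_nonneg n i x
    simp only [listEps, max_le_iff] at h
    have h2 : (boxC n).eps x i = 0 := by omega
    rw [listE, if_pos (by omega)]
    simp only [boxC] at h2 ⊢
    split_ifs at h2 with h3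
    · simp at h2
    · rw [Option.not_isSome_iff_eq_none.1 h3]; rfl

theorem Neu_append (n i : ℕ) (u v : List ℕ) : Neu n i (u ++ v) ↔ Neu n i u ∧ Neu n i v := by
  simp only [Neu, List.mem_append]
  exact ⟨fun h => ⟨fun x hx => h x (Or.inl hx), fun x hx => h x (Or.inr hx)⟩,
    fun h x hx => hx.elim (h.1 x) (h.2 x)⟩

theorem listEps_neu (n i : ℕ) (u w : List ℕ) (h : Neu n i u) :
    listEps (boxC n) i (u ++ w) = listEps (boxC n) i w := by
  induction u with
  | nil => rfl
  | cons x u ih =>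
    have hx := h x (by simp)
    have h0 := listEps_nonneg n i w
    rw [List.cons_append, listEps, ih (fun y hy => h y (by simp [hy]))]
    simp only [boxC, hx.1, hx.2] at h0 ⊢
    simpa using h0

theorem listE_neu (n i : ℕ) (u w : List ℕ) (h : Neu n i u) :
    listE (boxC n) i (u ++ w) = (listE (boxC n) i w).map (u ++ ·) := by
  induction u with
  | nil => simp
  | cons x u ih =>
    have hx := h x (by simp)
    have hu : Neu n i u := fun y hy => h y (by simp [hy])
    rw [List.cons_append, listE, ih hu, listEps_neu _ _ _ _ hu]
    have hp : (boxC n).phi x i = 0 := by simp [boxC, hx.2]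
    have he : (boxC n).e i x = none := by simp [boxC, hx.1]
    rw [hp, he]
    split_ifs with h0
    · rw [listE_none _ _ _ h0]; rfl
    · rw [Option.map_map]; rfl

theorem listF_neu (n i : ℕ) (u w : List ℕ) (h : Neu n i u) :
    listF (boxC n) i (u ++ w) = (listF (boxC n) i w).map (u ++ ·) := by
  induction u with
  | nil => simp
  | cons x u ih =>
    have hx := h x (by simp)
    have hu : Neu n i u := fun y hy => h y (by simp [hy])
    rw [List.cons_append, listF, ih hu, listEps_neu _ _ _ _ hu]
    have hp : (boxC n).phi x i = 0 := by simp [boxC, hx.2]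
    rw [hp, if_neg (not_lt.2 (listEps_nonneg n i w)), Option.map_map]; rfl

def o (b : Bool) (x : ℕ) : List ℕ := if b then [x] else []

def gE (p q p' q' : Bool) : Option (Bool × Bool × Bool × Bool) :=
  if (!p' && q') && !(p && !q) then some (p, q, true, false)
  else if !p && q then some (true, false, p', q') else none

def gF (p q p' q' : Bool) : Option (Bool × Bool × Bool × Bool) :=
  if (p && !q) && !(!p' && q') then some (false, true, p', q')
  else if p' && !q' then some (p, q, false, true) else none

structure Arrow (n i s t : ℕ) : Prop where
  es : boxCe n i s = none
  et : boxCe n i t = some s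
  fs : boxCf n i s = some t
  ft : boxCf n i t = none

theorem generic_E (n i s t s' t' : ℕ) (h : Arrow n i s t) (h' : Arrow n i s' t')
    (u0 u1 u2 : List ℕ) (h0 : Neu n i u0) (h1 : Neu n i u1) (h2 : Neu n i u2) (p q p' q' : Bool) :
    listE (boxC n) i (u0 ++ (o p s ++ (o q t ++ (u1 ++ (o p' s' ++ (o q' t' ++ u2)))))) =
      (gE p q p' q').map fun z =>
        u0 ++ (o z.1 s ++ (o z.2.1 t ++ (u1 ++ (o z.2.2.1 s' ++ (o z.2.2.2 t' ++ u2))))) := by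
  have e2 : listEps (boxC n) i u2 = 0 := by
    have := listEps_neu n i u2 [] h2
    simpa [listEps] using this
  have E2 : listE (boxC n) i u2 = none := listE_none _ _ _ e2.le
  have a1 : (boxC n).eps s i = 0 := by simp [boxC, h.es]
  have a2 : (boxC n).eps t i = 1 := by simp [boxC, h.et]
  have a3 : (boxC n).phi s i = 1 := by simp [boxC, h.fs]
  have a4 : (boxC n).phi t i = 0 := by simp [boxC, h.ft]
  have a5 : (boxC n).e i s = none := by simp [boxC, h.es]
  have a6 : (boxC n).e i t = some s := by simp [boxC, h.et]
  have b1 : (boxC n).eps s' i = 0 := by simp [boxC, h'.es]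
  have b2 : (boxC n).eps t' i = 1 := by simp [boxC, h'.et]
  have b3 : (boxC n).phi s' i = 1 := by simp [boxC, h'.fs]
  have b4 : (boxC n).phi t' i = 0 := by simp [boxC, h'.ft]
  have b5 : (boxC n).e i s' = none := by simp [boxC, h'.es]
  have b6 : (boxC n).e i t' = some s' := by simp [boxC, h'.et]
  rw [listE_neu _ _ _ _ h0]
  cases p <;> cases q <;> cases p' <;> cases q' <;>
    simp [o, gE, listE, listEps, listE_neu _ _ _ _ h1, listEps_neu _ _ _ _ h1, e2, E2, a1, a2, a3,
      a4, a5, a6, b1, b2, b3, b4, b5, b6]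

theorem generic_F (n i s t s' t' : ℕ) (h : Arrow n i s t) (h' : Arrow n i s' t')
    (u0 u1 u2 : List ℕ) (h0 : Neu n i u0) (h1 : Neu n i u1) (h2 : Neu n i u2) (p q p' q' : Bool) :
    listF (boxC n) i (u0 ++ (o p s ++ (o q t ++ (u1 ++ (o p' s' ++ (o q' t' ++ u2)))))) =
      (gF p q p' q').map fun z =>
        u0 ++ (o z.1 s ++ (o z.2.1 t ++ (u1 ++ (o z.2.2.1 s' ++ (o z.2.2.2 t' ++ u2))))) := by
  have e2 : listEps (boxC n) i u2 = 0 := by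
    have := listEps_neu n i u2 [] h2
    simpa [listEps] using this
  have E2 : listF (boxC n) i u2 = none := by
    have := listF_neu n i u2 [] h2
    simpa [listF] using this
  have a1 : (boxC n).eps s i = 0 := by simp [boxC, h.es]
  have a2 : (boxC n).eps t i = 1 := by simp [boxC, h.et]
  have a3 : (boxC n).phi s i = 1 := by simp [boxC, h.fs]
  have a4 : (boxC n).phi t i = 0 := by simp [boxC, h.ft]
  have a5 : (boxC n).f i s = some t := by simp [boxC, h.fs]
  have a6 : (boxC n).f i t = none := by simp [boxC, h.ft]
  have b1 : (boxC n).eps s' i = 0 := by simp [boxC, h'.es]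
  have b2 : (boxC n).eps t' i = 1 := by simp [boxC, h'.et]
  have b3 : (boxC n).phi s' i = 1 := by simp [boxC, h'.fs]
  have b4 : (boxC n).phi t' i = 0 := by simp [boxC, h'.ft]
  have b5 : (boxC n).f i s' = some t' := by simp [boxC, h'.fs]
  have b6 : (boxC n).f i t' = none := by simp [boxC, h'.ft]
  rw [listF_neu _ _ _ _ h0]
  cases p <;> cases q <;> cases p' <;> cases q' <;>
    simp [o, gF, listF, listEps, listF_neu _ _ _ _ h1, listEps_neu _ _ _ _ h1, e2, E2, a1, a2, a3,
      a4, a5, a6, b1, b2, b3, b4, b5, b6]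

def eloc (x y : Let) : Option (Let × Let) :=
  (gE x.2 y.2 x.1 y.1).map fun z => ((z.2.2.1, z.1), (z.2.2.2, z.2.1))

def floc (x y : Let) : Option (Let × Let) :=
  (gF x.2 y.2 x.1 y.1).map fun z => ((z.2.2.1, z.1), (z.2.2.2, z.2.1))

theorem eloc_dual (x y : Let) :
    (gE (!y.2) (!x.2) x.1 y.1).map (fun z => (((z.2.2.1, !z.2.1), (z.2.2.2, !z.1)) : Let × Let)) =
      eloc x y := by
  revert x y; decide

theorem floc_dual (x y : Let) :
    (gF (!y.2) (!x.2) x.1 y.1).map (fun z => (((z.2.2.1, !z.2.1), (z.2.2.2, !z.1)) : Let × Let)) =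
      floc x y := by
  revert x y; decide

theorem eloc_cnt : ∀ x y z, eloc x y = some z →
    cl [z.1, z.2] = cl [x, y] ∧ cr [z.1, z.2] = cr [x, y] := by
  decide

theorem floc_cnt : ∀ x y z, floc x y = some z →
    cl [z.1, z.2] = cl [x, y] ∧ cr [z.1, z.2] = cr [x, y] := by
  decide

theorem eloc_need (k : ℕ) (x y : Let) (z) (h : eloc x y = some z) :
    nd1 z.1 (nd1 z.2 k) = nd1 x (nd1 y k) := by
  obtain ⟨_ | _, _ | _⟩ := x <;> obtain ⟨_ | _, _ | _⟩ := y <;>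
    simp [eloc, gE] at h <;> subst h <;> simp [nd1]

theorem floc_need (k : ℕ) (x y : Let) (z) (h : floc x y = some z) :
    nd1 z.1 (nd1 z.2 k) = nd1 x (nd1 y k) := by
  obtain ⟨_ | _, _ | _⟩ := x <;> obtain ⟨_ | _, _ | _⟩ := y <;>
    simp [floc, gF] at h <;> subst h <;> simp [nd1]

theorem eloc_tl (k : ℕ) (x y : Let) :
    eloc (tl1 x (nd1 y k)) (tl1 y k) =
      (eloc x y).map fun z => (tl1 z.1 (nd1 z.2 k), tl1 z.2 k) := by
  rcases k with _ | _ | k <;>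
  obtain ⟨_ | _, _ | _⟩ := x <;> obtain ⟨_ | _, _ | _⟩ := y <;>
    simp [eloc, gE, tl1, nd1]

theorem floc_tl (k : ℕ) (x y : Let) :
    floc (tl1 x (nd1 y k)) (tl1 y k) =
      (floc x y).map fun z => (tl1 z.1 (nd1 z.2 k), tl1 z.2 k) := by
  rcases k with _ | _ | k <;>
  obtain ⟨_ | _, _ | _⟩ := x <;> obtain ⟨_ | _, _ | _⟩ := y <;>
    simp [floc, gF, tl1, nd1]

theorem dec_two (k : ℕ) (P Q : List Bool) (b c : Bool) :
    dec k (P ++ b :: c :: Q) = dec k P ++ (o b (k + P.length) ++ (o c (k + P.length + 1) ++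
      dec (k + P.length + 2) Q)) := by
  cases b <;> cases c <;> simp [dec_append, dec, o]

theorem arrow_hi (n i : ℕ) (h1 : 1 ≤ i) (h2 : i < n) : Arrow n i (2 * n - i - 1) (2 * n - i) := by
  constructor <;> grind [boxCe, boxCf]

theorem arrow_lo (n i : ℕ) (h1 : 1 ≤ i) (h2 : i < n) : Arrow n i (i - 1) i := by
  constructor <;> grind [boxCe, boxCf]

theorem neu_of (n i : ℕ) (h1 : 1 ≤ i) (h2 : i < n) (k : ℕ) (P : List Bool)
    (h : ∀ x, k ≤ x → x < k + P.length → x + 1 ≠ i ∧ x ≠ i ∧ x + i + 1 ≠ 2 * n ∧ x + i ≠ 2 * n) :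
    Neu n i (dec k P) := by
  intro x hx
  have hr := dec_range _ _ _ hx
  have := h x hr.1 hr.2
  constructor <;> grind [boxCe, boxCf]

theorem pr_word (n : ℕ) (A B : List Let) (x y : Let) (hn : A.length + 2 + B.length = n) :
    (pr n (A ++ x :: y :: B)).2 ++ (pr n (A ++ x :: y :: B)).1 =
      dec n (wr A) ++ (o x.2 (2 * n - (B.length + 1) - 1) ++ (o y.2 (2 * n - (B.length + 1)) ++
        ((dec (n + A.length + 2) (wr B) ++ dec n (wl A)) ++
          (o x.1 (2 * n - (B.length + 1) - 1) ++ (o y.1 (2 * n - (B.length + 1)) ++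
            dec (n + A.length + 2) (wl B)))))) := by
  have e1 : wr (A ++ x :: y :: B) = wr A ++ x.2 :: y.2 :: wr B := by simp [wr]
  have e2 : wl (A ++ x :: y :: B) = wl A ++ x.1 :: y.1 :: wl B := by simp [wl]
  have e3 : (wr A).length = A.length := by simp [wr]
  have e4 : (wl A).length = A.length := by simp [wl]
  have e5 : n + A.length = 2 * n - (B.length + 1) - 1 := by omega
  have e6 : n + A.length + 1 = 2 * n - (B.length + 1) := by omega
  rw [pr, e1, e2, dec_two, dec_two, e3, e4, e6, e5]
  simp only [List.append_assoc]

theorem tw_word (n : ℕ) (A B : List Let) (x y : Let) (hn : A.length + 2 + B.length = n) :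
    tw (A ++ x :: y :: B) =
      dec 0 (((wr B).map (fun b => !b)).reverse) ++ (o (!y.2) (B.length + 1 - 1) ++
        (o (!x.2) (B.length + 1) ++
        ((dec (B.length + 2) (((wr A).map (fun b => !b)).reverse) ++ dec n (wl A)) ++
          (o x.1 (2 * n - (B.length + 1) - 1) ++ (o y.1 (2 * n - (B.length + 1)) ++
            dec (n + A.length + 2) (wl B)))))) := by
  have e1 : ((wr (A ++ x :: y :: B)).map (fun b => !b)).reverse =
      ((wr B).map (fun b => !b)).reverse ++ (!y.2) :: (!x.2) ::
        ((wr A).map (fun b => !b)).reverse := by simp [wr]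
  have e2 : wl (A ++ x :: y :: B) = wl A ++ x.1 :: y.1 :: wl B := by simp [wl]
  have e3 : (((wr B).map (fun b => !b)).reverse).length = B.length := by simp [wr]
  have e4 : (wl A).length = A.length := by simp [wl]
  have e5 : n + A.length = 2 * n - (B.length + 1) - 1 := by omega
  have e6 : n + A.length + 1 = 2 * n - (B.length + 1) := by omega
  have e7 : (A ++ x :: y :: B).length = n := by simp; omega
  rw [tw, e1, e2, e7, dec_two, dec_two, e3, e4, e6, e5]
  simp only [List.append_assoc, Nat.zero_add, Nat.add_sub_cancel]

theorem pr_neu (n : ℕ) (A B : List Let) (hn : A.length + 2 + B.length = n) :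
    Neu n (B.length + 1) (dec n (wr A)) ∧
    Neu n (B.length + 1) (dec (n + A.length + 2) (wr B) ++ dec n (wl A)) ∧
    Neu n (B.length + 1) (dec (n + A.length + 2) (wl B)) := by
  have e1 : (wr A).length = A.length := by simp [wr]
  have e2 : (wl A).length = A.length := by simp [wl]
  have e3 : (wr B).length = B.length := by simp [wr]
  have e4 : (wl B).length = B.length := by simp [wl]
  rw [Neu_append]
  refine ⟨?_, ⟨?_, ?_⟩, ?_⟩ <;> apply neu_of <;> omega

theorem tw_neu (n : ℕ) (A B : List Let) (hn : A.length + 2 + B.length = n) :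
    Neu n (B.length + 1) (dec 0 (((wr B).map (fun b => !b)).reverse)) ∧
    Neu n (B.length + 1) (dec (B.length + 2) (((wr A).map (fun b => !b)).reverse) ++
      dec n (wl A)) := by
  have e1 : (((wr B).map (fun b => !b)).reverse).length = B.length := by simp [wr]
  have e2 : (((wr A).map (fun b => !b)).reverse).length = A.length := by simp [wr]
  have e3 : (wl A).length = A.length := by simp [wl]
  rw [Neu_append]
  refine ⟨?_, ?_, ?_⟩ <;> apply neu_of <;> omega

theorem tw_E (n : ℕ) (A B : List Let) (x y : Let) (hn : A.length + 2 + B.length = n) :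
    listE (boxC n) (B.length + 1) (tw (A ++ x :: y :: B)) =
      (eloc x y).map fun z => tw (A ++ z.1 :: z.2 :: B) := by
  rw [tw_word n A B x y hn]
  rw [generic_E n _ _ _ _ _ (arrow_lo n _ (by omega) (by omega))
    (arrow_hi n _ (by omega) (by omega)) _ _ _ (tw_neu n A B hn).1 (tw_neu n A B hn).2
    (pr_neu n A B hn).2.2, ← eloc_dual, Option.map_map]
  congr 1
  funext z
  simp only [Function.comp]
  rw [tw_word n A B _ _ hn]
  simp only [Bool.not_not]

theorem tw_F (n : ℕ) (A B : List Let) (x y : Let) (hn : A.length + 2 + B.length = n) :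
    listF (boxC n) (B.length + 1) (tw (A ++ x :: y :: B)) =
      (floc x y).map fun z => tw (A ++ z.1 :: z.2 :: B) := by
  rw [tw_word n A B x y hn]
  rw [generic_F n _ _ _ _ _ (arrow_lo n _ (by omega) (by omega))
    (arrow_hi n _ (by omega) (by omega)) _ _ _ (tw_neu n A B hn).1 (tw_neu n A B hn).2
    (pr_neu n A B hn).2.2, ← floc_dual, Option.map_map]
  congr 1
  funext z
  simp only [Function.comp]
  rw [tw_word n A B _ _ hn]
  simp only [Bool.not_not]

theorem pr_split (p q : List ℕ × List ℕ) (h : q.2.length = p.2.length) :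
    ((q.2 ++ q.1).drop p.2.length, (q.2 ++ q.1).take p.2.length) = q := by
  rw [← h]; simp

theorem pr_len (n : ℕ) (W : List Let) : (pr n W).2.length = cr W := by
  simp only [pr, dec_length]; rfl

theorem pr_E (n : ℕ) (A B : List Let) (x y : Let) (hn : A.length + 2 + B.length = n) :
    (pairPC n).e (B.length + 1) (pr n (A ++ x :: y :: B)) =
      (eloc x y).map fun z => pr n (A ++ z.1 :: z.2 :: B) := by
  simp only [pairPC]
  rw [if_neg (by omega)]
  obtain ⟨h0, h1, h2⟩ := pr_neu n A B hn
  have ha := arrow_hi n (B.length + 1) (by omega) (by omega)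
  have key : listE (boxC n) (B.length + 1)
      ((pr n (A ++ x :: y :: B)).2 ++ (pr n (A ++ x :: y :: B)).1) =
      (eloc x y).map fun z => (pr n (A ++ z.1 :: z.2 :: B)).2 ++ (pr n (A ++ z.1 :: z.2 :: B)).1 := by
    rw [pr_word n A B x y hn, generic_E n _ _ _ _ _ ha ha _ _ _ h0 h1 h2, eloc, Option.map_map]
    congr 1
    funext z
    simp only [Function.comp]
    rw [pr_word n A B _ _ hn]
  rw [key, Option.map_map]
  cases hz : eloc x y with
  | none => rfl
  | some z =>
    simp only [Option.map_some, Function.comp]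
    rw [pr_split]
    have := (eloc_cnt x y z hz).2
    simp only [pr_len, cr_append, cr_cons, cr_nil] at this ⊢
    omega

theorem pr_F (n : ℕ) (A B : List Let) (x y : Let) (hn : A.length + 2 + B.length = n) :
    (pairPC n).f (B.length + 1) (pr n (A ++ x :: y :: B)) =
      (floc x y).map fun z => pr n (A ++ z.1 :: z.2 :: B) := by
  simp only [pairPC]
  rw [if_neg (by omega)]
  obtain ⟨h0, h1, h2⟩ := pr_neu n A B hn
  have ha := arrow_hi n (B.length + 1) (by omega) (by omega)
  have key : listF (boxC n) (B.length + 1)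
      ((pr n (A ++ x :: y :: B)).2 ++ (pr n (A ++ x :: y :: B)).1) =
      (floc x y).map fun z => (pr n (A ++ z.1 :: z.2 :: B)).2 ++ (pr n (A ++ z.1 :: z.2 :: B)).1 := by
    rw [pr_word n A B x y hn, generic_F n _ _ _ _ _ ha ha _ _ _ h0 h1 h2, floc, Option.map_map]
    congr 1
    funext z
    simp only [Function.comp]
    rw [pr_word n A B _ _ hn]
  rw [key, Option.map_map]
  cases hz : floc x y with
  | none => rfl
  | some z =>
    simp only [Option.map_some, Function.comp]
    rw [pr_split]
    have := (floc_cnt x y z hz).2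
    simp only [pr_len, cr_append, cr_cons, cr_nil] at this ⊢
    omega

/-- Changing two adjacent letters of a word. -/
theorem tilde_change (n a : ℕ) (A B : List Let) (x y : Let) (z : Let × Let)
    (hn : A.length + 2 + B.length = n)
    (h : need 0 (A ++ x :: y :: B) = 0) (hu : un (A ++ x :: y :: B) = a)
    (hc : cl [z.1, z.2] = cl [x, y] ∧ cr [z.1, z.2] = cr [x, y])
    (hz : nd1 z.1 (nd1 z.2 (need 0 B)) = nd1 x (nd1 y (need 0 B))) :
    tildeMap n a (pr n (A ++ z.1 :: z.2 :: B)) =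
      tw (tl (nd1 x (nd1 y (need 0 B))) A ++ tl1 z.1 (nd1 z.2 (need 0 B)) ::
        tl1 z.2 (need 0 B) :: tl 0 B) := by
  have h2 : need 0 (A ++ z.1 :: z.2 :: B) = 0 := by
    rw [need_append] at h ⊢
    simp only [need, hz] at h ⊢
    exact h
  have h3 : un (A ++ z.1 :: z.2 :: B) = a := by
    have e1 := un_need (A ++ x :: y :: B)
    have e2 := un_need (A ++ z.1 :: z.2 :: B)
    simp only [h, h2, hu, cl_append, cr_append, cl_cons, cr_cons, cl_nil, cr_nil] at e1 e2 hc
    omega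
  have := tilde_pr n (A ++ z.1 :: z.2 :: B) (by simp; omega) h2
  rw [h3] at this
  rw [this, tl_append]
  simp only [tl, need, hz]

theorem comm_lt (n a : ℕ) (W : List Let) (hn : W.length = n) (h : need 0 W = 0) (hu : un W = a)
    (i : ℕ) (h1 : 1 ≤ i) (h2 : i < n) :
    ((pairPC n).e i (pr n W)).map (tildeMap n a) = listE (boxC n) i (tildeMap n a (pr n W)) ∧
    ((pairPC n).f i (pr n W)).map (tildeMap n a) = listF (boxC n) i (tildeMap n a (pr n W)) := by
  obtain ⟨A, x, y, B, rfl, rfl⟩ : ∃ A x y B, W = A ++ x :: y :: B ∧ i = B.length + 1 := by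
    refine ⟨W.take (n - i - 1), W[n - i - 1]'(by omega), W[n - i]'(by omega),
      W.drop (n - i + 1), ?_, ?_⟩
    · have e : n - i = (n - i - 1) + 1 := by omega
      have e2 := List.drop_eq_getElem_cons (l := W) (i := n - i) (by omega)
      have e3 := List.drop_eq_getElem_cons (l := W) (i := n - i - 1) (by omega)
      rw [← e] at e3
      rw [← e2, ← e3, List.take_append_drop]
    · rw [List.length_drop]; omega
  have hn' : A.length + 2 + B.length = n := by rw [← hn]; simp; omega
  have hl : (tl 0 B).length = B.length := tl_length _ _
  have hself := tilde_change n a A B x y (x, y) hn' h hu ⟨rfl, rfl⟩ rfl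
  simp only at hself
  have hn2 : (tl (nd1 x (nd1 y (need 0 B))) A).length + 2 + (tl 0 B).length = n := by
    simp only [tl_length]; omega
  constructor
  · rw [pr_E n A B x y hn', hself, Option.map_map, ← hl, tw_E n _ _ _ _ hn2, eloc_tl,
      Option.map_map]
    cases hz : eloc x y with
    | none => rfl
    | some z =>
      simp only [Option.map_some, Function.comp]
      rw [tilde_change n a A B x y z hn' h hu (eloc_cnt x y z hz) (eloc_need _ x y z hz)]
  · rw [pr_F n A B x y hn', hself, Option.map_map, ← hl, tw_F n _ _ _ _ hn2, floc_tl,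
      Option.map_map]
    cases hz : floc x y with
    | none => rfl
    | some z =>
      simp only [Option.map_some, Function.comp]
      rw [tilde_change n a A B x y z hn' h hu (floc_cnt x y z hz) (floc_need _ x y z hz)]

theorem arrow_n (n : ℕ) (h2 : 1 ≤ n) : Arrow n n (n - 1) n := by
  constructor <;> grind [boxCe, boxCf]

theorem neu_n (n : ℕ) (k : ℕ) (P : List Bool) (hn : 1 ≤ n)
    (h : ∀ x, k ≤ x → x < k + P.length → x + 1 ≠ n ∧ x ≠ n) :
    Neu n n (dec k P) := by
  intro x hx
  have hr := dec_range _ _ _ hx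
  have := h x hr.1 hr.2
  constructor <;> grind [boxCe, boxCf]

theorem tw_word1 (n : ℕ) (B : List Let) (x : Let) (hn : 1 + B.length = n) :
    tw (x :: B) = dec 0 (((wr B).map (fun b => !b)).reverse) ++ (o (!x.2) (n - 1) ++
      (o x.1 n ++ ([] ++ (o false (n - 1) ++ (o false n ++ dec (n + 1) (wl B)))))) := by
  have e1 : ((wr (x :: B)).map (fun b => !b)).reverse =
      ((wr B).map (fun b => !b)).reverse ++ [!x.2] := by simp [wr]
  have e3 : (((wr B).map (fun b => !b)).reverse).length = n - 1 := by simp [wr]; omega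
  have e7 : (x :: B).length = n := by simp; omega
  rw [tw, e1, e7, dec_split, e3]
  obtain ⟨_ | _, _ | _⟩ := x <;> simp [o, dec, wl]

theorem comm_n (n a : ℕ) (W : List Let) (hn : W.length = n) (h : need 0 W = 0) (hu : un W = a)
    (h1 : 1 ≤ n) :
    ((pairPC n).e n (pr n W)).map (tildeMap n a) = listE (boxC n) n (tildeMap n a (pr n W)) ∧
    ((pairPC n).f n (pr n W)).map (tildeMap n a) = listF (boxC n) n (tildeMap n a (pr n W)) := by
  obtain ⟨x, B, rfl⟩ : ∃ x B, W = x :: B := by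
    cases W with
    | nil => simp at hn; omega
    | cons x B => exact ⟨x, B, rfl⟩
  have hn' : 1 + B.length = n := by rw [← hn]; simp; omega
  have hlen : (pr n (x :: B)).2.length ≤ (pr n (x :: B)).1.length := by
    have h1 : (pr n (x :: B)).1.length = cl (x :: B) := by simp only [pr, dec_length]; rfl
    have := un_need (x :: B)
    rw [h1, pr_len]; omega
  have hself := tilde_pr n (x :: B) hn h
  rw [hu] at hself
  have hl : (tl 0 B).length = B.length := tl_length _ _
  have ha := arrow_n n h1
  have n0 : Neu n n (dec 0 (((wr (tl 0 B)).map (fun b => !b)).reverse)) := by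
    apply neu_n _ _ _ h1
    have : (((wr (tl 0 B)).map (fun b => !b)).reverse).length = B.length := by simp [wr, hl]
    omega
  have n1 : Neu n n [] := by intro x hx; simp at hx
  have n2 : Neu n n (dec (n + 1) (wl (tl 0 B))) := by
    apply neu_n _ _ _ h1; omega
  have hE := fun p q => generic_E n n _ _ _ _ ha ha _ _ _ n0 n1 n2 p q false false
  have hF := fun p q => generic_F n n _ _ _ _ ha ha _ _ _ n0 n1 n2 p q false false
  have hd : ∀ P : List Bool, (dec (n + 1) P).head? ≠ some n := by
    intro P hP
    have := dec_range _ _ _ (List.mem_of_mem_head? hP)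
    omega
  have hd2 : ∀ (P : List Bool), (match (dec (n + 1) P).head? with
      | some x => decide (n < x) | none => true) = true := by
    intro P
    split
    · rename_i z hz
      have := dec_range _ _ _ (List.mem_of_mem_head? hz)
      simp; omega
    · rfl
  have hfill : ∀ x' : Let, (x' = (true, true) ∨ x' = (false, false)) →
      (x = (true, true) ∨ x = (false, false)) →
      tildeMap n a (pr n (x' :: B)) = tw (x' :: tl 0 B) := by
    intro x' hx' hx
    have q1 : need 0 (x' :: B) = 0 := by
      rcases hx with rfl | rfl <;> rcases hx' with rfl | rfl <;> exact h
    have q2 : un (x' :: B) = a := by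
      rcases hx with rfl | rfl <;> rcases hx' with rfl | rfl <;> exact hu
    have := tilde_pr n (x' :: B) (by simpa using hn) q1
    rw [q2] at this
    rw [this, tl]
    rcases hx' with rfl | rfl <;> rfl
  rw [hself, tl, tw_word1 n _ _ (by omega), hE, hF]
  have hD : dominoTop n (pr n (x :: B)) = (x.1 && x.2) := by
    unfold dominoTop
    rw [decide_eq_true hlen]
    obtain ⟨_ | _, _ | _⟩ := x <;> simp [pr, wl, wr, dec, hd]
  have hCn : canDomino n (pr n (x :: B)) = (!x.1 && !x.2) := by
    unfold canDomino
    rw [decide_eq_true hlen]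
    obtain ⟨_ | _, _ | _⟩ := x <;>
      simp only [pr, wl, wr, List.map_cons, dec, hd2, List.head?_cons, Bool.and_true, Bool.true_and,
        Bool.not_true, Bool.not_false, Bool.and_false, Bool.false_and, lt_irrefl, decide_false]
  simp only [pairPC, if_true, hD, hCn]
  obtain ⟨_ | _, _ | _⟩ := x
  · have := hfill (true, true) (Or.inl rfl) (Or.inr rfl)
    rw [tw_word1 n _ _ (by omega)] at this
    simp only [tl1, gE, gF, Bool.not_false, Bool.not_true, Bool.and_true, Bool.and_false,
      Bool.false_and, if_true, Bool.false_eq_true, if_false, Option.map_none, Option.map_some,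
      true_and]
    exact congrArg some this
  · simp [tl1, gE, gF]
  · rcases hk : need 0 B with _ | k <;> simp [tl1, gE, gF]
  · have := hfill (false, false) (Or.inr rfl) (Or.inl rfl)
    rw [tw_word1 n _ _ (by omega)] at this
    simp only [tl1, gE, gF, Bool.not_false, Bool.not_true, Bool.and_true, Bool.and_false,
      Bool.false_and, if_true, Bool.false_eq_true, if_false, Option.map_none, Option.map_some,
      and_true]
    exact congrArg some this

theorem wtList_append (n : ℕ) (l m : List ℕ) (k : ℕ) :
    wtList n (l ++ m) k = wtList n l k + wtList n m k := by
  simp [wtList]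

theorem wt_zero (n k s : ℕ) (P : List Bool)
    (h : ∀ x, s ≤ x → x < s + P.length → x + 1 ≠ k ∧ x + k ≠ 2 * n) :
    wtList n (dec s P) k = 0 := by
  apply List.sum_eq_zero
  intro z hz
  simp only [List.mem_map] at hz
  obtain ⟨v, hv, rfl⟩ := hz
  have hr := dec_range _ _ _ hv
  have := h v hr.1 hr.2
  simp [wtBox, this]

theorem wt_dec_hi (n k : ℕ) (A B : List Bool) (b : Bool) (hA : A.length + k = n)
    (hB : B.length + 1 = k) : wtList n (dec n (A ++ b :: B)) k = if b then -1 else 0 := by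
  rw [dec_split, wtList_append, wtList_append, wt_zero, wt_zero]
  · cases b
    · simp [wtList]
    · simp [wtList, wtBox]; omega
  · intro x; omega
  · intro x; omega

theorem wt_dec_lo (n k : ℕ) (A B : List Bool) (b : Bool) (hA : A.length + k = n)
    (hB : B.length + 1 = k) : wtList n (dec 0 (B ++ b :: A)) k = if b then 1 else 0 := by
  rw [dec_split, wtList_append, wtList_append, wt_zero, wt_zero]
  · cases b
    · simp [wtList]
    · simp [wtList, wtBox]; omega
  · intro x; omega
  · intro x; omega

theorem wt_main (n : ℕ) (W : List Let) (hn : W.length = n) (k : ℕ) (h1 : 1 ≤ k) (h2 : k ≤ n) :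
    wtList n (tw (tl 0 W)) k = 1 + wtList n ((pr n W).1 ++ (pr n W).2) k := by
  obtain ⟨A, x, B, rfl, rfl⟩ : ∃ A x B, W = A ++ x :: B ∧ k = B.length + 1 := by
    refine ⟨W.take (n - k), W[n - k]'(by omega), W.drop (n - k + 1), by simp, ?_⟩
    rw [List.length_drop]; omega
  have hn' : A.length + (B.length + 1) = n := by rw [← hn]; simp
  rw [tl_append, tl]
  have hA := tl_length (need 0 (x :: B)) A
  have hB := tl_length 0 B
  generalize tl (need 0 (x :: B)) A = A' at *
  generalize tl 0 B = B' at *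
  generalize hk : need 0 B = kk
  have e7 : (A' ++ tl1 x kk :: B').length = n := by simp; omega
  rw [tw, e7]
  have e1 : ∀ z, ((wr (A' ++ z :: B')).map (fun b => !b)).reverse =
      ((wr B').map (fun b => !b)).reverse ++ (!z.2) ::
        ((wr A').map (fun b => !b)).reverse := by simp [wr]
  have e2 : ∀ (C D : List Let) z, wl (C ++ z :: D) = wl C ++ z.1 :: wl D := by simp [wl]
  have e3 : ∀ (C D : List Let) z, wr (C ++ z :: D) = wr C ++ z.2 :: wr D := by simp [wr]
  simp only [pr]
  rw [wtList_append, wtList_append, e1, e2, e2, e3, wt_dec_lo, wt_dec_hi, wt_dec_hi, wt_dec_hi]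
  · obtain ⟨_ | _, _ | _⟩ := x <;> rcases kk with _ | kk <;> simp [tl1]
  all_goals simp [wl, wr]
  all_goals omega

theorem bij_main (n a : ℕ) (ha : a < n) :
    Set.BijOn (tildeMap n a) (TCnSet n a) (KNcolC n (n - a)) := by
  refine ⟨?_, ?_, ?_⟩
  · intro p hp
    obtain ⟨W, hn, rfl, h, rfl⟩ := exists_word n a p hp
    rw [tilde_pr n W hn h]
    have hlen : (tw (tl 0 W)).length = n - un W := by
      have h1 := tw_length (tl 0 W)
      have h2 := cl_tl W
      have h3 := cr_tl W
      have h4 := un_need W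
      have h5 := tl_length 0 W
      omega
    refine ⟨hlen, List.isChain_iff_pairwise.2 ?_, ?_, ?_⟩
    · rw [tw_eq]; exact dec_pairwise _ _
    · intro x hx
      rw [tw_eq] at hx
      have := (dec_range _ _ _ hx).2
      simp [wr, wl, tl_length, hn] at this
      omega
    · rw [← hlen]
      exact (KN1_iff n _ (by rw [tl_length, hn])).2 (sc_tl W)
  · intro p hp q hq hpq
    obtain ⟨V, hn, rfl, h, hu⟩ := exists_word n a p hp
    obtain ⟨W, hn', rfl, h', hu'⟩ := exists_word n a q hq
    have e1 := tilde_pr n V hn h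
    have e2 := tilde_pr n W hn' h'
    rw [hu] at e1
    rw [hu'] at e2
    rw [e1, e2] at hpq
    have h3 := tw_inj _ _ (by simp [tl_length, hn, hn']) hpq
    have i1 := inv_tl V
    have i2 := inv_tl W
    rw [h, h3] at i1
    rw [h', i1] at i2
    rw [i2]
  · rintro l ⟨h1, h2, h3, h4⟩
    obtain ⟨P, hP, rfl⟩ := exists_dec (2 * n) 0 l (List.isChain_iff_pairwise.1 h2)
      (fun x hx => by have := h3 x hx; omega)
    have hX : ((P.take n).reverse.map (fun b => !b)).length = n := by simp; omega
    have hY : (P.drop n).length = n := by simp; omega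
    generalize hWd : (P.drop n).zip ((P.take n).reverse.map (fun b => !b)) = W'
    have hl : W'.length = n := by rw [← hWd, List.length_zip, hX, hY]; simp
    have hw : tw W' = dec 0 P := by
      rw [tw_eq, ← hWd, zip_wl _ _ (by omega), zip_wr _ _ (by omega)]
      congr 1
      simp [Function.comp_def]
    rw [← hw] at h1 h4 ⊢
    rw [← h1] at h4
    have hsc := (KN1_iff n W' hl).1 h4
    obtain ⟨k1, k2⟩ := need_inv W' 0 hsc (by simpa using sc_le W' hsc)
    have hl2 : (inv 0 W').length = n := by rw [inv_length, hl]
    have hu : un (inv 0 W') = a := by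
      have q1 := tw_length W'
      have q2 := cl_tl (inv 0 W')
      have q3 := cr_tl (inv 0 W')
      have q4 := un_need (inv 0 W')
      rw [k2] at q2 q3
      omega
    refine ⟨pr n (inv 0 W'), (mem_TCn n a _ hl2).2 ⟨k1, hu⟩, ?_⟩
    have := tilde_pr n _ hl2 k1
    rw [hu, k2] at this
    exact this

end KN

open KN

theorem tilde_crystal_iso (n a : ℕ) (hn : 2 ≤ n) (ha : a < n) :
    Set.BijOn (tildeMap n a) (TCnSet n a) (KNcolC n (n - a)) ∧
    (∀ p ∈ TCnSet n a, ∀ k, 1 ≤ k → k ≤ n →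
        wtList n (tildeMap n a p) k = 1 + wtList n (p.1 ++ p.2) k) ∧
    (∀ i, 1 ≤ i → i ≤ n → ∀ p ∈ TCnSet n a,
        ((pairPC n).e i p).map (tildeMap n a) = listE (boxC n) i (tildeMap n a p) ∧
        ((pairPC n).f i p).map (tildeMap n a) = listF (boxC n) i (tildeMap n a p)) := by
  refine ⟨bij_main n a ha, ?_, ?_⟩
  · intro p hp k h1 h2
    obtain ⟨W, hn, rfl, h, rfl⟩ := exists_word n a p hp
    rw [tilde_pr n W hn h]
    exact wt_main n W hn k h1 h2
  · intro i h1 h2 p hp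
    obtain ⟨W, hw, rfl, h, hu⟩ := exists_word n a p hp
    rcases Nat.lt_or_ge i n with h3 | h3
    · exact comm_lt n a W hw h hu i h1 h3
    · obtain rfl : i = n := by omega
      exact comm_n i a W hw h hu h1
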